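/- Let n and m be positive integers and let G be a Whitney-maximum graph in C_{n,m}. Then for each k ∈ {1,…,n}, G has the maximum k-order edge connectivity among all graphs in C_{n,m}: λ^{(k)}(G) ≥ λ^{(k)}(H) for every H ∈ C_{n,m}. -/

import Mathlib

open MvPolynomial

/-- Number of connected components of the spanning subgraph of a graph on `Fin n`
whose edge set is `s`. -/
noncomputable def ncomp (n : ℕ) (s : Set (Sym2 (Fin n))) : ℕ :=
  Nat.card (SimpleGraph.fromEdgeSet s).ConnectedComponent

/-- `G` is a member of `C_{n,m}`: a connected simple graph on `n` vertices and `m` edges. -/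
def IsCnm (n m : ℕ) (G : SimpleGraph (Fin n)) : Prop :=
  G.Connected ∧ G.edgeSet.ncard = m

/-- `N_i^{(k)}(G)`: the number of spanning subgraphs of `G` (identified with subsets of
`E(G)`) having exactly `i` edges and at most `k` connected components. -/
noncomputable def Ncnt (n : ℕ) (G : SimpleGraph (Fin n)) (i k : ℕ) : ℕ :=
  Set.ncard {s : Set (Sym2 (Fin n)) | s ⊆ G.edgeSet ∧ s.ncard = i ∧ ncomp n s ≤ k}

/-- `N_{i,j}(G)`: the number of spanning subgraphs of `G` having exactly `i` edges and
exactly `j` connected components. -/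
noncomputable def Nexact (n : ℕ) (G : SimpleGraph (Fin n)) (i j : ℕ) : ℕ :=
  Set.ncard {s : Set (Sym2 (Fin n)) | s ⊆ G.edgeSet ∧ s.ncard = i ∧ ncomp n s = j}

/-- The `k`-reliability of `G` at `p`: `R_G^{(k)}(p) = Σ_{i=0}^m N_i^{(k)}(G) p^i (1-p)^{m-i}`. -/
noncomputable def rel (n m : ℕ) (G : SimpleGraph (Fin n)) (k : ℕ) (p : ℝ) : ℝ :=
  ∑ i ∈ Finset.range (m + 1), (Ncnt n G i k : ℝ) * p ^ i * (1 - p) ^ (m - i)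

/-- The Tutte polynomial of `G`, `T_G(x,y) = Σ_{H ∈ S(G)} (x-1)^{r(G)-r(H)} (y-1)^{c(H)}`,
where the rank of the spanning subgraph with edge set `s` is `n - ncomp n s`, so that
`r(G) - r(H) = ncomp n s - ncomp n G.edgeSet`, and the corank is `s.ncard + ncomp n s - n`. -/
noncomputable def tutte (n : ℕ) (G : SimpleGraph (Fin n)) : MvPolynomial (Fin 2) ℝ :=
  ∑ᶠ s ∈ {t : Set (Sym2 (Fin n)) | t ⊆ G.edgeSet},
    (X 0 - 1) ^ (ncomp n s - ncomp n G.edgeSet) * (X 1 - 1) ^ (s.ncard + ncomp n s - n)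

/-- The Whitney polynomial of `G`, `W_G(x,y) = Σ_{H ∈ S(G)} x^{r(G)-r(H)} y^{c(H)}`. -/
noncomputable def whitney (n : ℕ) (G : SimpleGraph (Fin n)) : MvPolynomial (Fin 2) ℝ :=
  ∑ᶠ s ∈ {t : Set (Sym2 (Fin n)) | t ⊆ G.edgeSet},
    X 0 ^ (ncomp n s - ncomp n G.edgeSet) * X 1 ^ (s.ncard + ncomp n s - n)

/-- A bivariate polynomial is nonnegative if all its coefficients are nonnegative. -/
def NonnegPoly (P : MvPolynomial (Fin 2) ℝ) : Prop :=
  ∀ d : Fin 2 →₀ ℕ, 0 ≤ P.coeff d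

/-- `G` is Tutte-maximum in `C_{n,m}`. -/
def TutteMaximum (n m : ℕ) (G : SimpleGraph (Fin n)) : Prop :=
  ∀ H : SimpleGraph (Fin n), IsCnm n m H →
    ∃ P : MvPolynomial (Fin 2) ℝ, NonnegPoly P ∧
      tutte n G - tutte n H = (X 0 + X 1 - X 0 * X 1) * P

/-- `G` is Whitney-maximum in `C_{n,m}`. -/
def WhitneyMaximum (n m : ℕ) (G : SimpleGraph (Fin n)) : Prop :=
  ∀ H : SimpleGraph (Fin n), IsCnm n m H →
    ∃ Q : MvPolynomial (Fin 2) ℝ, NonnegPoly Q ∧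
      whitney n G - whitney n H = (1 - X 0 * X 1) * Q

/-- `G` is strong in `C_{n,m}`. -/
def Strong (n m : ℕ) (G : SimpleGraph (Fin n)) : Prop :=
  ∀ H : SimpleGraph (Fin n), IsCnm n m H →
    ∀ i ≤ m, ∀ k, 1 ≤ k → k ≤ n → Ncnt n H i k ≤ Ncnt n G i k

/-- `G` is a 0-element in `C_{n,m}`. -/
def ZeroElement (n m : ℕ) (G : SimpleGraph (Fin n)) : Prop :=
  ∀ H : SimpleGraph (Fin n), IsCnm n m H → ∀ i ≤ m, Ncnt n H i 1 ≤ Ncnt n G i 1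

/-- `t_k(G)`: the number of spanning forests of `G` composed of exactly `k` trees. -/
noncomputable def tcount (n : ℕ) (G : SimpleGraph (Fin n)) (k : ℕ) : ℕ :=
  Set.ncard {s : Set (Sym2 (Fin n)) |
    s ⊆ G.edgeSet ∧ (SimpleGraph.fromEdgeSet s).IsAcyclic ∧ ncomp n s = k}

/-- `λ^{(k)}(G)`: the minimum number of edges that must be removed from `G` to obtain a
spanning subgraph with more than `k` connected components. -/
noncomputable def lamk (n : ℕ) (G : SimpleGraph (Fin n)) (k : ℕ) : ℕ :=
  sInf {d : ℕ | ∃ D : Set (Sym2 (Fin n)),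
    D ⊆ G.edgeSet ∧ D.ncard = d ∧ k < ncomp n (G.edgeSet \ D)}

/-- `∂^{a+b} P / ∂x^a ∂y^b` evaluated at `(0,0)`. -/
noncomputable def pdevalXY (P : MvPolynomial (Fin 2) ℝ) (a b : ℕ) : ℝ :=
  MvPolynomial.eval (fun _ => (0 : ℝ))
    ((fun q => MvPolynomial.pderiv (0 : Fin 2) q)^[a]
      ((fun q => MvPolynomial.pderiv (1 : Fin 2) q)^[b] P))

/-- The edge set of a spanning subgraph together with one representative of each component but one
can be completed to a connected graph, so the corank is nonnegative. -/
theorem le_ncard_add_ncomp {n : ℕ} (hn : 0 < n) (s : Set (Sym2 (Fin n))) :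
    n ≤ s.ncard + ncomp n s := by
  classical
  set F := SimpleGraph.fromEdgeSet s with hF
  let r : F.ConnectedComponent → Fin n := fun c => c.exists_rep.choose
  have hr : ∀ c, F.connectedComponentMk (r c) = c := fun c => c.exists_rep.choose_spec
  let c₀ := F.connectedComponentMk ⟨0, hn⟩
  let f : F.ConnectedComponent → Sym2 (Fin n) := fun c => s(r c₀, r c)
  let T : Set (Sym2 (Fin n)) := s ∪ f '' {c₀}ᶜ
  have hle : F ≤ SimpleGraph.fromEdgeSet T :=
    SimpleGraph.fromEdgeSet_mono Set.subset_union_left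
  have hreach : ∀ v, (SimpleGraph.fromEdgeSet T).Reachable (r c₀) v := by
    intro v
    have h1 : F.Reachable (r (F.connectedComponentMk v)) v :=
      SimpleGraph.ConnectedComponent.eq.1 (hr _)
    refine SimpleGraph.Reachable.trans ?_ (h1.mono hle)
    by_cases hc : F.connectedComponentMk v = c₀
    · rw [hc]
    · refine SimpleGraph.Adj.reachable ?_
      rw [SimpleGraph.fromEdgeSet_adj]
      refine ⟨Or.inr ⟨_, hc, rfl⟩, fun h => hc ?_⟩
      rw [← hr (F.connectedComponentMk v), ← h, hr]
  have hconn : (SimpleGraph.fromEdgeSet T).Connected :=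
    { preconnected := fun u v => (hreach u).symm.trans (hreach v)
      nonempty := ⟨⟨0, hn⟩⟩ }
  have h := hconn.card_vert_le_card_edgeSet_add_one
  rw [Nat.card_eq_fintype_card, Fintype.card_fin, Nat.card_coe_set_eq,
    SimpleGraph.edgeSet_fromEdgeSet] at h
  have h2 : T.ncard ≤ s.ncard + (f '' {c₀}ᶜ).ncard := Set.ncard_union_le _ _
  have h3 : (f '' {c₀}ᶜ).ncard ≤ ({c₀}ᶜ : Set _).ncard := Set.ncard_image_le
  have h4 := Set.ncard_add_ncard_compl ({c₀} : Set F.ConnectedComponent)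
  rw [Set.ncard_singleton] at h4
  have h5 : ncomp n s = Nat.card F.ConnectedComponent := rfl
  have h6 : (T \ Sym2.diagSet).ncard ≤ T.ncard := Set.ncard_le_ncard Set.sdiff_subset
  omega

theorem ncomp_pos {n : ℕ} (hn : 0 < n) (s : Set (Sym2 (Fin n))) : 0 < ncomp n s :=
  have : Nonempty (SimpleGraph.fromEdgeSet s).ConnectedComponent :=
    ⟨SimpleGraph.connectedComponentMk _ ⟨0, hn⟩⟩
  Nat.card_pos

theorem ncomp_le (n : ℕ) (s : Set (Sym2 (Fin n))) : ncomp n s ≤ n := by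
  simpa [ncomp] using
    Nat.card_le_card_of_surjective (SimpleGraph.fromEdgeSet s).connectedComponentMk Quot.mk_surjective

theorem ncomp_empty (n : ℕ) : ncomp n ∅ = n := by
  have := le_antisymm (ncomp_le n ∅)
  rcases Nat.eq_zero_or_pos n with rfl | hn
  · simpa using ncomp_le 0 ∅
  · exact this (by simpa using le_ncard_add_ncomp hn ∅)

theorem SimpleGraph.Connected.ncomp_edgeSet {n : ℕ} {G : SimpleGraph (Fin n)} (hG : G.Connected) :
    ncomp n G.edgeSet = 1 := by
  have := hG.preconnected.subsingleton_connectedComponent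
  have := hG.nonempty
  have : Nonempty G.ConnectedComponent := ⟨G.connectedComponentMk this.some⟩
  rw [ncomp, SimpleGraph.fromEdgeSet_edgeSet, Nat.card_eq_one_iff_unique]
  exact ⟨‹_›, ‹_›⟩

/-- Indicator of the exponents `(a, b)` with `a < k` on the diagonal `b - a = i + 1 - n`; these are
the exponents contributed to the Whitney polynomial by spanning subgraphs with `i` edges and at most
`k` components. -/
noncomputable def diagWeight (n i k : ℕ) (d : Fin 2 →₀ ℕ) : ℝ :=
  if d 0 < k ∧ d 1 + n = d 0 + 1 + i then 1 else 0

/-- The sum of the coefficients of a polynomial over the exponents selected by `diagWeight`. -/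
noncomputable def diagSum (n i k : ℕ) : MvPolynomial (Fin 2) ℝ →ₗ[ℝ] ℝ :=
  (basisMonomials (Fin 2) ℝ).constr ℝ (diagWeight n i k)

theorem diagSum_monomial (n i k : ℕ) (d : Fin 2 →₀ ℕ) (c : ℝ) :
    diagSum n i k (monomial d c) = c * diagWeight n i k d := by
  have h : monomial d c = c • basisMonomials (Fin 2) ℝ d := by
    simp [smul_monomial]
  rw [h, map_smul, diagSum, Module.Basis.constr_basis, smul_eq_mul]

theorem X_pow_mul_X_pow_eq_monomial (a b : ℕ) :
    (X 0 ^ a * X 1 ^ b : MvPolynomial (Fin 2) ℝ) =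
      monomial (Finsupp.single 0 a + Finsupp.single 1 b) 1 := by
  rw [X_pow_eq_monomial, X_pow_eq_monomial, monomial_mul, one_mul]

theorem diagSum_one_sub_mul_nonneg (n i k : ℕ) {Q : MvPolynomial (Fin 2) ℝ} (hQ : NonnegPoly Q) :
    0 ≤ diagSum n i k ((1 - X 0 * X 1) * Q) := by
  rw [Q.as_sum, Finset.mul_sum, map_sum]
  refine Finset.sum_nonneg fun d _ => ?_
  have hX : (X 0 * X 1 : MvPolynomial (Fin 2) ℝ) =
      monomial (Finsupp.single 0 1 + Finsupp.single 1 1) 1 := by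
    simpa using X_pow_mul_X_pow_eq_monomial 1 1
  rw [sub_mul, one_mul, hX, monomial_mul, one_mul, map_sub, diagSum_monomial, diagSum_monomial,
    ← mul_sub]
  refine mul_nonneg (hQ d) (sub_nonneg.2 ?_)
  simp only [diagWeight, Finsupp.add_apply]
  simp only [Finsupp.single_apply]
  simp only [if_true, one_ne_zero, zero_ne_one, if_false, add_zero, zero_add]
  split_ifs
  · exact le_rfl
  · omega
  · exact zero_le_one
  · exact le_rfl

theorem diagSum_whitney {n : ℕ} (hn : 0 < n) {G : SimpleGraph (Fin n)} (hG : G.Connected)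
    (i k : ℕ) : diagSum n i k (whitney n G) = Ncnt n G i k := by
  classical
  have hfin : {t : Set (Sym2 (Fin n)) | t ⊆ G.edgeSet}.Finite := Set.toFinite _
  rw [whitney, finsum_mem_eq_finite_toFinset_sum _ hfin, map_sum]
  simp only [X_pow_mul_X_pow_eq_monomial, diagSum_monomial, one_mul, diagWeight]
  rw [Finset.sum_boole, Ncnt, ← Set.ncard_coe_finset]
  congr 2
  ext s
  have h1 := ncomp_pos hn s
  have h2 := le_ncard_add_ncomp hn s
  simp only [Finset.coe_filter, Set.Finite.mem_toFinset, Set.mem_ofPred_eq, hG.ncomp_edgeSet,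
    Finsupp.add_apply]
  simp only [Finsupp.single_apply]
  simp only [if_true, one_ne_zero, zero_ne_one, if_false, add_zero, zero_add]
  refine and_congr_right fun _ => ?_
  omega

theorem WhitneyMaximum.ncnt_le {n m : ℕ} (hn : 0 < n) {G H : SimpleGraph (Fin n)}
    (hW : WhitneyMaximum n m G) (hG : IsCnm n m G) (hH : IsCnm n m H) (i k : ℕ) :
    Ncnt n H i k ≤ Ncnt n G i k := by
  obtain ⟨Q, hQ, h⟩ := hW H hH
  have h0 := diagSum_one_sub_mul_nonneg n i k hQ
  rw [← h, map_sub, diagSum_whitney hn hG.1, diagSum_whitney hn hH.1, sub_nonneg] at h0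
  exact_mod_cast h0

theorem ncard_subsets_ncard_eq {α : Type*} [Finite α] (E : Set α) (i : ℕ) :
    {s : Set α | s ⊆ E ∧ s.ncard = i}.ncard = E.ncard.choose i := by
  classical
  have := Fintype.ofFinite α
  rw [Set.ncard_eq_toFinset_card' E, ← Finset.card_powersetCard, ← Set.ncard_coe_finset,
    ← Set.ncard_image_of_injective _ Finset.coe_injective]
  congr 1
  ext s
  simp only [Set.mem_ofPred_eq, Set.mem_image, Finset.mem_coe, Finset.mem_powersetCard]
  refine ⟨fun h => ⟨s.toFinset, ⟨by simpa using h.1, ?_⟩, by simp⟩, ?_⟩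
  · rw [← h.2, Set.ncard_eq_toFinset_card']
  · rintro ⟨t, ⟨ht, rfl⟩, rfl⟩
    exact ⟨by simpa [← Finset.coe_subset] using ht, Set.ncard_coe_finset t⟩

/-- each Whitney-maximum graph in `C_{n,m}` has maximum `k`-order edge
connectivity for every `k ∈ {1,…,n}`. -/
theorem stmt17 (n m : ℕ) (hn : 0 < n) (hm : 0 < m) (G : SimpleGraph (Fin n))
    (hG : IsCnm n m G) (hW : WhitneyMaximum n m G) :
    ∀ k, 1 ≤ k → k ≤ n → ∀ H : SimpleGraph (Fin n), IsCnm n m H →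
      lamk n H k ≤ lamk n G k := by
  intro k _ hkn H hH
  rcases hkn.eq_or_lt with rfl | hkn
  · refine (Nat.sInf_eq_zero.2 (Or.inr ?_)).trans_le (Nat.zero_le _)
    exact Set.eq_empty_of_forall_notMem fun d ⟨D, _, _, h⟩ => (ncomp_le k _).not_gt h
  obtain ⟨D, hDG, hD, hDk⟩ : lamk n G k ∈ {d : ℕ | ∃ D : Set (Sym2 (Fin n)),
      D ⊆ G.edgeSet ∧ D.ncard = d ∧ k < ncomp n (G.edgeSet \ D)} :=
    Nat.sInf_mem ⟨_, G.edgeSet, subset_rfl, rfl, by simpa [ncomp_empty] using hkn⟩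
  have hcard : (G.edgeSet \ D).ncard = m - lamk n G k := by
    rw [Set.ncard_sdiff hDG, hG.2, hD]
  have hle : lamk n G k ≤ m := by
    rw [← hD, ← hG.2]
    exact Set.ncard_le_ncard hDG
  by_contra! hlt
  have hH_all : ∀ s ⊆ H.edgeSet, s.ncard = m - lamk n G k → ncomp n s ≤ k := by
    intro s hs hsc
    by_contra! hk
    refine (Nat.sInf_le (?_ : lamk n G k ∈ {d : ℕ | ∃ D : Set (Sym2 (Fin n)),
      D ⊆ H.edgeSet ∧ D.ncard = d ∧ k < ncomp n (H.edgeSet \ D)})).not_gt hlt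
    refine ⟨H.edgeSet \ s, Set.sdiff_subset, ?_, ?_⟩
    · rw [Set.ncard_sdiff hs, hH.2, hsc]
      omega
    · rwa [Set.sdiff_sdiff_cancel_left hs]
  have h1 : Ncnt n H (m - lamk n G k) k = m.choose (m - lamk n G k) := by
    rw [← hH.2, ← ncard_subsets_ncard_eq, Ncnt, hH.2]
    congr 1
    ext s
    exact ⟨fun h => ⟨h.1, h.2.1⟩, fun h => ⟨h.1, h.2, hH_all s h.1 h.2⟩⟩
  have h2 : Ncnt n G (m - lamk n G k) k < m.choose (m - lamk n G k) := by
    conv_rhs => rw [← hG.2]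
    rw [← ncard_subsets_ncard_eq, Ncnt, hG.2]
    refine Set.ncard_lt_ncard ⟨fun s h => ⟨h.1, h.2.1⟩, fun h => ?_⟩
    exact (h ⟨Set.sdiff_subset, hcard⟩).2.2.not_gt hDk
  exact (h1 ▸ hW.ncnt_le hn hG hH _ _).not_gt h2
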